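/- arXiv:2505.08700 — 3 statements merged into one kernel-verified Lean document; each statement's English description precedes it below -/
import Mathlib

section
/- Let (X, d) be a metric space and T : X → X a nonexpansive map. Then a point u ∈ X is non-wandering for T if and only if it is recurrent for T; that is, the non-wandering set Ω(T) equals the recurrent set R(T). -/
/-- The ω-limit set of a point `u` under iteration of `T`: the set of points `w` such that
for every `ε > 0` and every `N` there exists `k ≥ N` with `dist (T^[k] u) w < ε`. -/
def omegaLimitSet {X : Type*} [MetricSpace X] (T : X → X) (u : X) : Set X :=
  {w | ∀ ε > (0 : ℝ), ∀ N : ℕ, ∃ k ≥ N, dist (T^[k] u) w < ε}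

/-- A point is recurrent if it belongs to its own ω-limit set. -/
def IsRecurrentPt {X : Type*} [MetricSpace X] (T : X → X) (u : X) : Prop :=
  u ∈ omegaLimitSet T u

/-- A point `u` is non-wandering if for every `ε > 0` and every `N` there exist `k ≥ N`
and `v` with `dist u v < ε` and `dist (T^[k] v) u < ε`. -/
def IsNonWanderingPt {X : Type*} [MetricSpace X] (T : X → X) (u : X) : Prop :=
  ∀ ε > (0 : ℝ), ∀ N : ℕ, ∃ k ≥ N, ∃ v : X, dist u v < ε ∧ dist (T^[k] v) u < ε

/-- Iterates of a nonexpansive map are nonexpansive. -/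
theorem dist_iterate_le_of_nonexpansive {X : Type*} [PseudoMetricSpace X] {T : X → X}
    (hT : ∀ a b : X, dist (T a) (T b) ≤ dist a b) (k : ℕ) (a b : X) :
    dist (T^[k] a) (T^[k] b) ≤ dist a b := by
  have h := ((LipschitzWith.mk_one hT).iterate k).dist_le_mul a b
  simpa using h

/-- For a nonexpansive map on a metric space, a point is non-wandering if and only if it is
recurrent: `Ω(T) = R(T)`. -/
theorem nonWandering_iff_recurrent_of_nonexpansive {X : Type*} [MetricSpace X] (T : X → X)
    (hT : ∀ a b : X, dist (T a) (T b) ≤ dist a b) (u : X) :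
    IsNonWanderingPt T u ↔ IsRecurrentPt T u := by
  constructor
  · intro h ε hε N
    obtain ⟨k, hk, v, huv, hvu⟩ := h (ε / 2) (half_pos hε) N
    refine ⟨k, hk, ?_⟩
    calc dist (T^[k] u) u ≤ dist (T^[k] u) (T^[k] v) + dist (T^[k] v) u := dist_triangle _ _ _
      _ ≤ dist u v + dist (T^[k] v) u := by
        gcongr
        exact dist_iterate_le_of_nonexpansive hT k u v
      _ < ε := by linarith
  · intro h ε hε N
    obtain ⟨k, hk, hku⟩ := h ε hε N
    exact ⟨k, hk, u, by simpa using hε, hku⟩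
end

section
/- (Triangle inequality for the Peierls barrier.) Let M be a set and h : ℕ → M → M → ℝ a family satisfying the chain inequality h_{m+n}(x, z) ≤ h_m(x, y) + h_n(y, z) for all m, n ∈ ℕ and all x, y, z ∈ M, and assume that for all x, y ∈ M the real sequence (h_n(x, y))_n is bounded. Then the Peierls barrier h^∞(x, y) := liminf_{n → ∞} h_n(x, y) satisfies the triangle inequality h^∞(x, z) ≤ h^∞(x, y) + h^∞(y, z) for all x, y, z ∈ M. -/
/-- Triangle inequality for the Peierls barrier: if the family `h n` satisfies the chain
inequality `h (m+n) x z ≤ h m x y + h n y z` and is pointwise bounded, then the Peierls barrier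
`h^∞(x,y) = liminf_n h n x y` satisfies the triangle inequality. -/
theorem peierls_barrier_triangle {M : Type*} (h : ℕ → M → M → ℝ)
    (hchain : ∀ m n x y z, h (m + n) x z ≤ h m x y + h n y z)
    (hbdd : ∀ x y, ∃ C, ∀ n, |h n x y| ≤ C) :
    ∀ x y z : M, Filter.liminf (fun n => h n x z) Filter.atTop ≤
      Filter.liminf (fun n => h n x y) Filter.atTop +
        Filter.liminf (fun n => h n y z) Filter.atTop := by
  intro x y z
  have below (u v : M) : Filter.IsBoundedUnder (· ≥ ·) Filter.atTop (fun n => h n u v) := by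
    obtain ⟨C, hC⟩ := hbdd u v
    exact Filter.isBoundedUnder_of ⟨-C, fun n => (abs_le.mp (hC n)).1⟩
  have cobounded (u v : M) :
      Filter.IsCoboundedUnder (· ≥ ·) Filter.atTop (fun n => h n u v) := by
    obtain ⟨C, hC⟩ := hbdd u v
    exact (Filter.isBoundedUnder_of ⟨C, fun n => (abs_le.mp (hC n)).2⟩ :
      Filter.IsBoundedUnder (· ≤ ·) Filter.atTop (fun n => h n u v)).isCoboundedUnder_ge
  refine le_of_forall_pos_le_add fun ε hε => ?_
  have hxy := Filter.frequently_lt_of_liminf_lt (cobounded x y)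
    (lt_add_of_pos_right _ (half_pos hε))
  have hyz := Filter.frequently_lt_of_liminf_lt (cobounded y z)
    (lt_add_of_pos_right _ (half_pos hε))
  refine Filter.liminf_le_of_frequently_le (Filter.frequently_atTop.mpr fun N => ?_) (below x z)
  obtain ⟨m, hm, hmxy⟩ := Filter.frequently_atTop.mp hxy N
  obtain ⟨n, -, hnyz⟩ := Filter.frequently_atTop.mp hyz 0
  exact ⟨m + n, by omega, by linarith [hchain m n x y z]⟩
end

section
/- Let ρ : ℕ → ℕ satisfy ρ(n) ≥ 1 for all n, let Λ(n) = lcm(ρ(0), …, ρ(n)), and define ρ'(0) = ρ(0) and ρ'(n+1) = Λ(n+1) / Λ(n). Then for every prime p, the sum ∑_{n=0}^{∞} ν_p(ρ'(n)), computed in ℕ ∪ {∞}, equals sup_{n ≥ 0} ν_p(ρ(n)), where ν_p denotes the p-adic valuation on positive integers. In other words, the multiplicity function of the sequence ρ' is m(p) = sup_n ν_p(ρ(n)). -/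
/-- The partial sums of the valuations of the successive quotients of a divisibility chain
telescope. -/
theorem sum_factorization_quotient_of_dvd_succ {L r : ℕ → ℕ} (hL : ∀ n, L n ≠ 0)
    (hdvd : ∀ n, L n ∣ L (n + 1)) (h0 : r 0 = L 0) (hs : ∀ n, r (n + 1) = L (n + 1) / L n)
    (p n : ℕ) :
    ∑ i ∈ Finset.range (n + 1), (r i).factorization p = (L n).factorization p := by
  induction n with
  | zero => simp [h0]
  | succ n ih =>
    have hle := (Nat.factorization_le_iff_dvd (hL n) (hL (n + 1))).2 (hdvd n) p
    rw [Finset.sum_range_succ, ih, hs, Nat.factorization_div (hdvd n), Finsupp.tsub_apply]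
    omega


/-- The multiplicity function of the derived sequence `ρ'` (given by `ρ' 0 = ρ 0`,
`ρ' (n+1) = Λ (n+1) / Λ n` where `Λ n = lcm (ρ 0, …, ρ n)`) is
`m(p) = ∑_n ν_p (ρ' n) = sup_n ν_p (ρ n)`, the sum being computed in `ℕ ∪ {∞}`. -/
theorem multiplicity_function_derived_seq (ρ : ℕ → ℕ) (hρ : ∀ n, 1 ≤ ρ n)
    (Λ : ℕ → ℕ) (hΛ : ∀ n, Λ n = (Finset.range (n + 1)).lcm ρ)
    (ρ' : ℕ → ℕ) (h0 : ρ' 0 = ρ 0) (hs : ∀ n, ρ' (n + 1) = Λ (n + 1) / Λ n)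
    (p : ℕ) (hp : p.Prime) :
    ∑' n : ℕ, (padicValNat p (ρ' n) : ℕ∞) = ⨆ n : ℕ, (padicValNat p (ρ n) : ℕ∞) := by
  have hρ0 : ∀ n, ρ n ≠ 0 := fun n => Nat.one_le_iff_ne_zero.1 (hρ n)
  have hΛ0 : ∀ n, Λ n ≠ 0 := fun n => by
    rw [hΛ, Ne, Finset.lcm_eq_zero_iff]
    simp [hρ0]
  have hdvd : ∀ n, Λ n ∣ Λ (n + 1) := fun n => by
    rw [hΛ, hΛ]
    exact Finset.lcm_mono (Finset.range_subset_range.2 (Nat.le_succ _))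
  have hsum (n : ℕ) : ∑ i ∈ Finset.range (n + 1), (ρ' i).factorization p =
      (Finset.range (n + 1)).sup fun i => (ρ i).factorization p := by
    rw [sum_factorization_quotient_of_dvd_succ hΛ0 hdvd (by simp [h0, hΛ]) hs, hΛ,
      Finset.factorization_lcm fun k _ => hρ0 k]
  simp_rw [← Nat.factorization_def _ hp]
  refine (hasSum_of_isLUB _ ⟨?_, fun b hb => iSup_le fun n => ?_⟩).tsum_eq
  · rintro _ ⟨s, rfl⟩
    obtain ⟨n, hn⟩ := s.exists_nat_subset_range
    calc ∑ i ∈ s, ((ρ' i).factorization p : ℕ∞)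
        ≤ ∑ i ∈ Finset.range (n + 1), ((ρ' i).factorization p : ℕ∞) :=
          Finset.sum_le_sum_of_subset
            (hn.trans (Finset.range_subset_range.2 (Nat.le_succ n)))
      _ = ((Finset.range (n + 1)).sup fun i => (ρ i).factorization p : ℕ) := by
          rw [← hsum, Nat.cast_sum]
      _ ≤ ⨆ n, ((ρ n).factorization p : ℕ∞) := by
          obtain ⟨i, -, hi⟩ := Finset.exists_mem_eq_sup (Finset.range (n + 1))
            Finset.nonempty_range_add_one fun i => (ρ i).factorization p
          rw [hi]
          exact le_iSup (fun n => ((ρ n).factorization p : ℕ∞)) i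
  · refine le_trans ?_ (hb ⟨Finset.range (n + 1), rfl⟩)
    beta_reduce
    rw [← Nat.cast_sum, hsum, Nat.cast_le]
    exact Finset.le_sup (f := fun i => (ρ i).factorization p) (Finset.self_mem_range_succ n)
end
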